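/- There exists a constant C > 0, depending only on C_H and d, such that for every δ > 0, x, x' ∈ 𝕋^d, p ∈ ℝ^d, μ ∈ P(𝕋^d), if v and v' are classical (C²) solutions of the discounted cell problem δw(y) − tr(a D²w(y)) + H(z, y, p, Dw(y), μ) = 0 on 𝕋^d with parameter z = x and z = x' respectively, then sup_{y∈𝕋^d} |v(y) − v'(y)| ≤ (C/δ)(1 + |p|) d(x, x'), where d(x,x') is the torus distance. -/

import Mathlib

noncomputable section

open MeasureTheory Metric Filter
open scoped RealInnerProductSpace ENNReal Topology

instance : Fact ((0:ℝ) < 1) := ⟨one_pos⟩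

/-- Euclidean space `ℝ^d`. -/
abbrev Euc (d : ℕ) := EuclideanSpace ℝ (Fin d)

/-- The flat torus `𝕋^d = ℝ^d/ℤ^d`, realized as a product of circles. -/
abbrev Torus (d : ℕ) := Fin d → AddCircle (1 : ℝ)

/-- Canonical projection `ℝ^d → 𝕋^d`. -/
def Torus.proj {d : ℕ} (y : Euc d) : Torus d := fun i => (y i : AddCircle (1 : ℝ))

/-- The 1-Wasserstein distance between two (probability) measures on a metric
measurable space: the infimum over all couplings of the expected distance. -/
def W1 {X : Type*} [MeasurableSpace X] [PseudoMetricSpace X] (μ ν : Measure X) : ℝ :=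
  ⨅ π : {π : Measure (X × X) //
      IsProbabilityMeasure π ∧ π.map Prod.fst = μ ∧ π.map Prod.snd = ν},
    ∫ z, dist z.1 z.2 ∂(π : Measure (X × X))

/-- `P(𝕋^d)`: Borel probability measures on the torus. -/
abbrev ProbT (d : ℕ) := ProbabilityMeasure (Torus d)

/-- 1-Wasserstein distance on `P(𝕋^d)`. -/
def W1T {d : ℕ} (μ ν : ProbT d) : ℝ := W1 (μ : Measure (Torus d)) (ν : Measure (Torus d))

/-- Second partial derivative `∂²v/∂yᵢ∂yⱼ`. -/
def hess {d : ℕ} (v : Euc d → ℝ) (y : Euc d) (i j : Fin d) : ℝ :=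
  iteratedFDeriv ℝ 2 v y ![EuclideanSpace.single i 1, EuclideanSpace.single j 1]

/-- `tr(a D²v)(y)` for a constant matrix `a`. -/
def trAH {d : ℕ} (a : Matrix (Fin d) (Fin d) ℝ) (v : Euc d → ℝ) (y : Euc d) : ℝ :=
  ∑ i, ∑ j, a i j * hess v y j i

/-- The `ℤ^d`-periodic lift of a function on the torus. -/
def tlift {d : ℕ} (v : Torus d → ℝ) : Euc d → ℝ := fun y => v (Torus.proj y)

/-- `v : 𝕋^d → ℝ` is a classical (C²) solution of the discounted cell problem
`δ v(y) - tr(a D²v(y)) + H(x, y, p, Dv(y), μ) = 0` on `𝕋^d`. -/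
def IsSol {d : ℕ} (a : Matrix (Fin d) (Fin d) ℝ)
    (H : Torus d → Torus d → Euc d → Euc d → ProbT d → ℝ)
    (δ : ℝ) (x : Torus d) (p : Euc d) (μ : ProbT d) (v : Torus d → ℝ) : Prop :=
  ContDiff ℝ 2 (tlift v) ∧
  ∀ y : Euc d,
    δ * v (Torus.proj y) - trAH a (tlift v) y
      + H x (Torus.proj y) p (gradient (tlift v) y) μ = 0

/-- The second directional derivative of a `C²` function is nonpositive at a global maximum. -/
lemma fderiv_fderiv_apply_self_nonpos {E : Type*} [NormedAddCommGroup E] [NormedSpace ℝ E]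
    {w : E → ℝ} (hw : ContDiff ℝ 2 w) {y : E} (hmax : ∀ z, w z ≤ w y) (b : E) :
    fderiv ℝ (fderiv ℝ w) y b b ≤ 0 := by
  have hd : Differentiable ℝ w := hw.differentiable (by norm_num)
  have hd2 : Differentiable ℝ (fderiv ℝ w) :=
    (hw.fderiv_right (m := 1) (by norm_num)).differentiable (by norm_num)
  have hline : ∀ t : ℝ, HasDerivAt (fun t : ℝ => y + t • b) b t := fun t => by
    simpa using ((hasDerivAt_id t).smul_const b).const_add y
  let g : ℝ → ℝ := fun t => w (y + t • b)
  have hg : ∀ t, HasDerivAt g (fderiv ℝ w (y + t • b) b) t := fun t =>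
    (hd _).hasFDerivAt.comp_hasDerivAt t (hline t)
  have hg' : deriv g = fun t => fderiv ℝ w (y + t • b) b := funext fun t => (hg t).deriv
  have hg2 : deriv (deriv g) 0 = fderiv ℝ (fderiv ℝ w) y b b := by
    rw [hg']
    have h := ((hd2 _).hasFDerivAt.comp_hasDerivAt (0 : ℝ) (hline 0)).clm_apply
      (hasDerivAt_const (0 : ℝ) b)
    simpa using h.deriv
  have hgmax : ∀ t, g t ≤ g 0 := fun t => by simpa [g] using hmax (y + t • b)
  have hg0 : deriv g 0 = 0 :=
    IsLocalMax.deriv_eq_zero (Filter.Eventually.of_forall hgmax)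
  by_contra! hpos
  rw [← hg2] at hpos
  have hmin : IsLocalMin g 0 :=
    isLocalMin_of_deriv_deriv_pos hpos hg0 (hg 0).continuousAt
  have hconst : g =ᶠ[𝓝 0] fun _ => g 0 := hmin.mono fun t ht => le_antisymm (hgmax t) ht
  have : deriv (deriv g) 0 = 0 := by
    rw [hconst.deriv.deriv_eq]
    simp
  exact hpos.ne' this

lemma trAH_sub {d : ℕ} (a : Matrix (Fin d) (Fin d) ℝ) {u v : Euc d → ℝ}
    (hu : ContDiff ℝ 2 u) (hv : ContDiff ℝ 2 v) (y : Euc d) :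
    trAH a (fun z => u z - v z) y = trAH a u y - trAH a v y := by
  have h : iteratedFDeriv ℝ 2 (fun z => u z - v z) y
      = iteratedFDeriv ℝ 2 u y - iteratedFDeriv ℝ 2 v y :=
    iteratedFDeriv_sub_apply hu.contDiffAt hv.contDiffAt
  simp only [trAH, hess, h, sub_apply, mul_sub, Finset.sum_sub_distrib]

/-- `tr(a D²w) ≤ 0` at a global maximum of `w` if `a` is positive semidefinite. -/
lemma trAH_nonpos_of_max {d : ℕ} {a : Matrix (Fin d) (Fin d) ℝ} (ha : a.PosSemidef)
    {w : Euc d → ℝ} (hw : ContDiff ℝ 2 w) {y : Euc d} (hmax : ∀ z, w z ≤ w y) :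
    trAH a w y ≤ 0 := by
  obtain ⟨m, B, rfl⟩ := Matrix.posSemidef_iff_eq_sum_vecMulVec.mp ha
  let b : Fin m → Euc d := fun k => ∑ i, B k i • EuclideanSpace.single i (1 : ℝ)
  have h : trAH (∑ k, Matrix.vecMulVec (B k) (star (B k))) w y
      = ∑ k, fderiv ℝ (fderiv ℝ w) y (b k) (b k) := by
    simp only [trAH, hess, iteratedFDeriv_two_apply, Matrix.sum_apply, Matrix.vecMulVec_apply, b,
      map_sum, map_smul, star_trivial, sum_apply, smul_apply, smul_eq_mul,
      Finset.sum_mul, Finset.mul_sum, Matrix.cons_val_zero, Matrix.cons_val_one]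
    rw [Finset.sum_comm_cycle]
    refine Finset.sum_congr rfl fun k _ => Finset.sum_congr rfl fun i _ =>
      Finset.sum_congr rfl fun j _ => ?_
    ring
  rw [h]
  exact Finset.sum_nonpos fun k _ => fderiv_fderiv_apply_self_nonpos hw hmax (b k)

lemma AddCircle.coe_sub_intCast (s : ℝ) (n : ℤ) :
    ((s - n : ℝ) : AddCircle (1 : ℝ)) = s := by
  rw [AddCircle.coe_sub, sub_eq_self, AddCircle.coe_eq_zero_iff]
  exact ⟨n, by simp⟩

lemma Torus.proj_surjective {d : ℕ} : Function.Surjective (Torus.proj (d := d)) := fun x => by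
  choose t ht using fun i => QuotientAddGroup.mk_surjective (x i)
  exact ⟨WithLp.toLp 2 t, funext ht⟩

/-- Points of the torus have representatives whose distance is controlled by the torus distance. -/
lemma Torus.exists_proj_eq_norm_sub_le {d : ℕ} (x x' : Torus d) :
    ∃ X X' : Euc d, Torus.proj X = x ∧ Torus.proj X' = x' ∧
      ‖X - X'‖ ≤ (d + 1) * dist x x' := by
  obtain ⟨X', rfl⟩ := Torus.proj_surjective x'
  have hrep : ∀ z : AddCircle (1 : ℝ), ∃ t : ℝ, (t : AddCircle (1 : ℝ)) = z ∧ |t| = ‖z‖ := by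
    intro z
    obtain ⟨s, rfl⟩ := QuotientAddGroup.mk_surjective z
    refine ⟨s - round s, ?_, ?_⟩
    · exact AddCircle.coe_sub_intCast s (round s)
    · exact (UnitAddCircle.norm_eq (x := s)).symm
  choose t ht hnt using fun i => hrep (x i - Torus.proj X' i)
  refine ⟨X' + WithLp.toLp 2 t, X', ?_, rfl, ?_⟩
  · funext i
    have := ht i
    simp only [Torus.proj, PiLp.add_apply, AddCircle.coe_add] at this ⊢
    rw [this]; abel
  · have hD := dist_nonneg (x := x) (y := Torus.proj X')
    rw [add_sub_cancel_left]
    refine abs_le_of_sq_le_sq' ?_ (by positivity) |>.2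
    rw [EuclideanSpace.norm_sq_eq]
    calc ∑ i, ‖t i‖ ^ 2 ≤ ∑ _i : Fin d, dist x (Torus.proj X') ^ 2 := by
          refine Finset.sum_le_sum fun i _ => ?_
          gcongr
          rw [Real.norm_eq_abs, hnt, ← dist_eq_norm]
          exact dist_le_pi_dist x (Torus.proj X') i
      _ = d * dist x (Torus.proj X') ^ 2 := by simp
      _ ≤ ((d + 1) * dist x (Torus.proj X')) ^ 2 := by
          rw [mul_pow]
          gcongr
          nlinarith [(Nat.cast_nonneg d : (0 : ℝ) ≤ d)]

/-- A function on the torus with continuous lift attains its maximum. -/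
lemma exists_max_tlift {d : ℕ} {w : Torus d → ℝ} (hw : Continuous (tlift w)) :
    ∃ y : Euc d, ∀ z, tlift w z ≤ tlift w y := by
  have hK : IsCompact ((WithLp.toLp 2 : (Fin d → ℝ) → Euc d) '' Set.Icc 0 1) :=
    isCompact_Icc.image (PiLp.continuous_toLp 2 _)
  obtain ⟨y, -, hy⟩ := hK.exists_isMaxOn ⟨_, 0, by simp, rfl⟩ hw.continuousOn
  refine ⟨y, fun z => ?_⟩
  have hz : Torus.proj (WithLp.toLp 2 (fun i => Int.fract (z i)) : Euc d) = Torus.proj z := by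
    exact funext fun i => AddCircle.coe_sub_intCast (z i) ⌊z i⌋
  have := hy ⟨fun i => Int.fract (z i),
    ⟨fun i => Int.fract_nonneg _, fun i => (Int.fract_lt_one _).le⟩, rfl⟩
  simpa only [tlift, Set.mem_ofPred_eq, hz] using this

/-- Comparison principle: a one-sided bound on the difference of the Hamiltonians bounds the
difference of solutions. -/
lemma IsSol.sub_le {d : ℕ} {a : Matrix (Fin d) (Fin d) ℝ} (ha : a.PosSemidef)
    {H : Torus d → Torus d → Euc d → Euc d → ProbT d → ℝ} {δ : ℝ} (hδ : 0 < δ)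
    {x x' : Torus d} {p : Euc d} {μ : ProbT d} {v v' : Torus d → ℝ}
    (hv : IsSol a H δ x p μ v) (hv' : IsSol a H δ x' p μ v') {M : ℝ}
    (hM : ∀ y q, H x' y p q μ - H x y p q μ ≤ M) (y : Torus d) :
    v y - v' y ≤ M / δ := by
  have hw : ContDiff ℝ 2 (fun z => tlift v z - tlift v' z) := hv.1.sub hv'.1
  obtain ⟨y₀, hy₀⟩ := exists_max_tlift (w := fun z => v z - v' z) hw.continuous
  have htr : trAH a (tlift v) y₀ - trAH a (tlift v') y₀ ≤ 0 := by
    rw [← trAH_sub a hv.1 hv'.1]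
    exact trAH_nonpos_of_max ha hw hy₀
  have hgrad : gradient (tlift v) y₀ = gradient (tlift v') y₀ := by
    have h0 : fderiv ℝ (fun z => tlift v z - tlift v' z) y₀ = 0 :=
      IsLocalMax.fderiv_eq_zero (Filter.Eventually.of_forall hy₀)
    rw [fderiv_fun_sub (hv.1.differentiable (by norm_num) _)
      (hv'.1.differentiable (by norm_num) _), sub_eq_zero] at h0
    rw [gradient, gradient, h0]
  have e := hv.2 y₀
  have e' := hv'.2 y₀
  rw [hgrad] at e
  have hM₀ := hM (Torus.proj y₀) (gradient (tlift v') y₀)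
  obtain ⟨Y, rfl⟩ := Torus.proj_surjective y
  have hY : v (Torus.proj Y) - v' (Torus.proj Y) ≤ v (Torus.proj y₀) - v' (Torus.proj y₀) := hy₀ Y
  rw [le_div_iff₀ hδ]
  nlinarith

/-- There is a constant `C > 0`, depending only on `C_H` and `d`, such that for
any two classical solutions `v, v'` of the discounted cell problem with parameters `x` and `x'`
(and the same `δ, p, μ`), `sup_y |v(y) − v'(y)| ≤ (C/δ)(1 + |p|) d(x, x')`. -/
theorem discounted_solutions_x_stability (d : ℕ) (C_H : ℝ) :
    ∃ C : ℝ, 0 < C ∧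
      ∀
    -- `a = σ₂σ₂ᵀ + σ_{0,2}σ_{0,2}ᵀ` is a constant symmetric positive definite matrix
    (a : Matrix (Fin d) (Fin d) ℝ) (ha : a.PosDef) (haS : a.IsSymm)
    -- `A ⊂ ℝ^{2d}` is a compact set of controls
    (A : Set (Euc (2*d))) (hA : IsCompact A)
    -- the data `c, f, L`, continuous and Lipschitz in `(x,y,μ)` uniformly in `α ∈ A`
    (c f : Torus d → Torus d → Euc (2*d) → ProbT d → Euc d)
    (L : Torus d → Torus d → Euc (2*d) → ProbT d → ℝ)
    (hccont : ∀ μ, Continuous fun z : Torus d × Torus d × Euc (2*d) => c z.1 z.2.1 z.2.2 μ)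
    (hfcont : ∀ μ, Continuous fun z : Torus d × Torus d × Euc (2*d) => f z.1 z.2.1 z.2.2 μ)
    (hLcont : ∀ μ, Continuous fun z : Torus d × Torus d × Euc (2*d) => L z.1 z.2.1 z.2.2 μ)
    (K : ℝ)
    (hclip : ∀ x x' y y' α μ μ', α ∈ A →
      ‖c x y α μ - c x' y' α μ'‖ ≤ K * (dist x x' + dist y y' + W1T μ μ'))
    (hflip : ∀ x x' y y' α μ μ', α ∈ A →
      ‖f x y α μ - f x' y' α μ'‖ ≤ K * (dist x x' + dist y y' + W1T μ μ'))
    (hLlip : ∀ x x' y y' α μ μ', α ∈ A →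
      |L x y α μ - L x' y' α μ'| ≤ K * (dist x x' + dist y y' + W1T μ μ'))
    -- the Bellman Hamiltonian
    (H : Torus d → Torus d → Euc d → Euc d → ProbT d → ℝ)
    (hHdef : ∀ x y p q μ,
      H x y p q μ =
        sSup ((fun α => -⟪p, c x y α μ⟫ - ⟪q, f x y α μ⟫ - L x y α μ) '' A))
    (β : ℝ) (hβ0 : 0 < β) (hβ1 : β < 1)
    (hHC2 : ∀ μ, ContDiff ℝ 2
      (fun z : Euc d × Euc d × Euc d × Euc d =>
        H (Torus.proj z.1) (Torus.proj z.2.1) z.2.2.1 z.2.2.2 μ))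
    -- with second derivative locally β-Hölder continuous uniformly in `μ`
    (hHholder : ∀ R : ℝ, 0 < R → ∃ C : ℝ, ∀ μ, ∀ z z' : Euc d × Euc d × Euc d × Euc d,
      ‖z‖ ≤ R → ‖z'‖ ≤ R →
      ‖iteratedFDeriv ℝ 2 (fun w : Euc d × Euc d × Euc d × Euc d =>
          H (Torus.proj w.1) (Torus.proj w.2.1) w.2.2.1 w.2.2.2 μ) z
        - iteratedFDeriv ℝ 2 (fun w : Euc d × Euc d × Euc d × Euc d =>
          H (Torus.proj w.1) (Torus.proj w.2.1) w.2.2.1 w.2.2.2 μ) z'‖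
        ≤ C * ‖z - z'‖ ^ β)
    -- `|D_x H| ≤ C_H (1+|p|)` and `|D_p H| ≤ C_H (1+|p|)`
    (hDx : ∀ (x : Euc d) (y : Torus d) (p q : Euc d) (μ : ProbT d),
      ‖fderiv ℝ (fun x' : Euc d => H (Torus.proj x') y p q μ) x‖ ≤ C_H * (1 + ‖p‖))
    (hDp : ∀ (x y : Torus d) (p q : Euc d) (μ : ProbT d),
      ‖fderiv ℝ (fun p' : Euc d => H x y p' q μ) p‖ ≤ C_H * (1 + ‖p‖))
      (δ : ℝ), 0 < δ →
      ∀ (x x' : Torus d) (p : Euc d) (μ : ProbT d) (v v' : Torus d → ℝ),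
        IsSol a H δ x p μ v → IsSol a H δ x' p μ v' →
          (⨆ y : Torus d, |v y - v' y|) ≤ (C / δ) * (1 + ‖p‖) * dist x x' := by
  refine ⟨(|C_H| + 1) * (d + 1), by positivity, ?_⟩
  intro a ha _ A _ c f L _ _ _ K _ _ _ H _ β _ _ hHC2 _ hDx _ δ hδ x x' p μ v v' hv hv'
  have hH : ∀ y q, |H x y p q μ - H x' y p q μ|
      ≤ (|C_H| + 1) * (d + 1) * (1 + ‖p‖) * dist x x' := by
    intro y q
    obtain ⟨X, X', rfl, rfl, hX⟩ := Torus.exists_proj_eq_norm_sub_le x x'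
    obtain ⟨Y, rfl⟩ := Torus.proj_surjective y
    have hdiff : Differentiable ℝ fun Z : Euc d => H (Torus.proj Z) (Torus.proj Y) p q μ :=
      ((hHC2 μ).comp (contDiff_id.prodMk contDiff_const :
        ContDiff ℝ 2 fun Z : Euc d => (Z, (Y, p, q)))).differentiable (by norm_num)
    have hlip := convex_univ.norm_image_sub_le_of_norm_fderiv_le (𝕜 := ℝ)
      (fun Z _ => hdiff Z) (fun Z _ => hDx Z (Torus.proj Y) p q μ)
      (Set.mem_univ X') (Set.mem_univ X)
    have hC : C_H ≤ |C_H| + 1 := by linarith [le_abs_self C_H]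
    calc _ ≤ C_H * (1 + ‖p‖) * ‖X - X'‖ := hlip
      _ ≤ (|C_H| + 1) * (1 + ‖p‖) * ((d + 1) * dist (Torus.proj X) (Torus.proj X')) := by gcongr
      _ = _ := by ring
  refine ciSup_le fun y => ?_
  have h := hv.sub_le ha.posSemidef hδ hv'
    (fun y q => (neg_sub (H x y p q μ) _ ▸ neg_le_abs _).trans (hH y q)) y
  have h' := hv'.sub_le ha.posSemidef hδ hv
    (fun y q => (le_abs_self _).trans (hH y q)) y
  rw [show (|C_H| + 1) * (d + 1) / δ * (1 + ‖p‖) * dist x x'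
    = (|C_H| + 1) * (d + 1) * (1 + ‖p‖) * dist x x' / δ by ring]
  exact abs_le.mpr ⟨by linarith, h⟩
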